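/- arXiv:2010.12817 — 3 statements merged into one kernel-verified Lean document; each statement's English description precedes it below -/
import Mathlib

section
/- Let A be an associative unital ℂ-algebra and let L, L' be simple A-modules with L not isomorphic to L' and with End_A(L) = End_A(L') = ℂ. Let m be a natural number and let N be an A-module whose socle is isomorphic to the direct sum of m copies of L and such that N/Soc(N) is isomorphic to L'. If N is indecomposable, then m ≤ dim_ℂ Ext¹_A(L', L). -/
open CategoryTheory

/-- The socle of a module: the sum of all simple submodules. -/
def socle (A : Type) [Ring A] (N : Type) [AddCommGroup N] [Module A N] :
    Submodule A N :=
  sSup {m : Submodule A N | IsSimpleModule A ↥m}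

/-- A module is indecomposable if it is nonzero and is not the direct sum of
two nonzero submodules. -/
def Indecomposable (A : Type) [Ring A] (N : Type) [AddCommGroup N] [Module A N] : Prop :=
  Nontrivial N ∧ ∀ p q : Submodule A N, IsCompl p q → p = ⊥ ∨ q = ⊥

/-- `dim_ℂ Ext¹_A(L', L)`, as a cardinal, for modules over a `ℂ`-algebra `A`. -/
noncomputable def ext1Rank (A : Type) [Ring A] [Algebra ℂ A]
    (L' L : Type) [AddCommGroup L'] [Module A L'] [AddCommGroup L] [Module A L] :
    Cardinal :=
  Module.rank ℂ
    (((Ext ℂ (ModuleCat.{0} A) 1).obj (Opposite.op (ModuleCat.of A L'))).obj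
      (ModuleCat.of A L))

/-- A linear injection from cocycles modulo coboundaries gives a rank bound. -/
theorem rank_le_homology_aux {m : ℕ} (K : CochainComplex (ModuleCat.{0} ℂ) ℕ)
    (c : (Fin m → ℂ) →ₗ[ℂ] K.X 1)
    (hc : ∀ v, (K.d 1 2).hom (c v) = 0)
    (hinj : ∀ v (y : K.X 0), (K.d 0 1).hom y = c v → v = 0) :
    (m : Cardinal) ≤ Module.rank ℂ (K.homology 1) := by
  let k : ModuleCat.of ℂ (Fin m → ℂ) ⟶ K.cycles 1 :=
    K.liftCycles (ModuleCat.ofHom c) 2 (by simp) (by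
      apply ModuleCat.hom_ext
      exact LinearMap.ext hc)
  have hk : k ≫ K.iCycles 1 = ModuleCat.ofHom c := by simp [k]
  have hex : (ShortComplex.mk (K.toCycles 0 1) (K.homologyπ 1) (by simp)).Exact :=
    ShortComplex.exact_of_g_is_cokernel _ (K.homologyIsCokernel 0 1 (by simp))
  rw [ShortComplex.moduleCat_exact_iff] at hex
  have key : Function.Injective (k ≫ K.homologyπ 1).hom := by
    rw [injective_iff_map_eq_zero]
    intro v hv
    obtain ⟨y, hy⟩ := hex (k.hom v) hv
    refine hinj v y ?_
    have h1 : (K.toCycles 0 1 ≫ K.iCycles 1).hom y = (k ≫ K.iCycles 1).hom v := by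
      simp only [ModuleCat.hom_comp, LinearMap.comp_apply]
      exact congrArg _ hy
    rw [hk, K.toCycles_i] at h1
    exact h1
  have := LinearMap.rank_le_of_injective _ key
  simpa using this

/-- A map from the socle that extends to the indecomposable module is zero. -/
theorem extends_eq_zero (A : Type) [Ring A] 
    (L L' N : Type) [AddCommGroup L] [Module A L] [AddCommGroup L'] [Module A L']
    [AddCommGroup N] [Module A N]
    (hL : IsSimpleModule A L) (hL' : IsSimpleModule A L')
    (m : ℕ)
    (esoc : (socle A N) ≃ₗ[A] (Fin m → L))
    (equo : (N ⧸ socle A N) ≃ₗ[A] L')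
    (hindec : _root_.Indecomposable A N) (F : N →ₗ[A] L) :
    F ∘ₗ (socle A N).subtype = 0 := by
  by_contra hf
  have hss : IsSemisimpleModule A (socle A N) := IsSemisimpleModule.congr esoc
  set f := F ∘ₗ (socle A N).subtype with hfdef
  have hsurj : Function.Surjective f := (LinearMap.surjective_or_eq_zero f).resolve_right hf
  obtain ⟨T, hT⟩ := exists_isCompl (LinearMap.ker f)
  have hcompl : IsCompl (LinearMap.ker F) (T.map (socle A N).subtype) := by
    constructor
    · rw [Submodule.disjoint_def]
      rintro x hx ⟨t, ht, rfl⟩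
      have := (Submodule.disjoint_def.1 hT.disjoint) t hx ht
      simp [this]
    · rw [codisjoint_iff, eq_top_iff]
      intro n _
      obtain ⟨s, hs⟩ := hsurj (F n)
      have hs' : s ∈ LinearMap.ker f ⊔ T := by rw [hT.sup_eq_top]; trivial
      obtain ⟨a, ha, t, ht, rfl⟩ := Submodule.mem_sup.1 hs'
      refine Submodule.mem_sup.2 ⟨n - t, ?_, t, ⟨t, ht, rfl⟩, by simp⟩
      have hft : f t = F n := by
        rw [← hs, map_add, LinearMap.mem_ker.1 ha, zero_add]
      rw [LinearMap.mem_ker, map_sub, ← hft]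
      simp [hfdef]
  rcases hindec.2 _ _ hcompl with h | h
  · have hFs : Function.Surjective F := fun y => by
      obtain ⟨s, hs⟩ := hsurj y
      exact ⟨s, hs⟩
    have e : N ≃ₗ[A] L := LinearEquiv.ofBijective F ⟨LinearMap.ker_eq_bot.1 h, hFs⟩
    have hN : IsSimpleModule A N := IsSimpleModule.congr e
    have htop : socle A N = ⊤ := by
      rw [eq_top_iff]
      apply le_sSup
      exact IsSimpleModule.congr Submodule.topEquiv
    have : Subsingleton (N ⧸ socle A N) := Submodule.Quotient.subsingleton_iff.2 htop
    have := IsSimpleModule.nontrivial A L'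
    exact not_subsingleton L' equo.symm.toEquiv.subsingleton
  · have hT0 : T = ⊥ := by
      apply Submodule.map_injective_of_injective (Submodule.subtype_injective (socle A N))
      rw [h, Submodule.map_bot]
    rw [hT0] at hT
    exact hf (LinearMap.ker_eq_top.1 (by simpa using hT.sup_eq_top))

/-- Linear algebra form of the connecting map argument. -/
theorem extension_aux (A : Type) [Ring A] {N L L' P0 P1 : Type}
    [AddCommGroup L] [Module A L] [AddCommGroup L'] [Module A L']
    [AddCommGroup N] [Module A N] [AddCommGroup P0] [Module A P0] [AddCommGroup P1] [Module A P1]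
    (S : Submodule A N) (q : N →ₗ[A] L') (hq : LinearMap.ker q = S)
    (p : P0 →ₗ[A] L') (hp : Function.Surjective p) (d : P1 →ₗ[A] P0)
    (hd : ∀ x, p x = 0 → ∃ y, d y = x)
    (g : P0 →ₗ[A] N) (hg : q ∘ₗ g = p) (h : P1 →ₗ[A] S) (hh : S.subtype ∘ₗ h = g ∘ₗ d)
    (f : S →ₗ[A] L) (ψ : P0 →ₗ[A] L) (hψ : f ∘ₗ h = ψ ∘ₗ d) :
    ∃ F : N →ₗ[A] L, F ∘ₗ S.subtype = f := by
  let σ : (P0 × S) →ₗ[A] N := g.coprod S.subtype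
  let τ : (P0 × S) →ₗ[A] L := ψ.coprod f
  have hσ : Function.Surjective σ := by
    intro n
    obtain ⟨x, hx⟩ := hp (q n)
    have : n - g x ∈ S := by
      rw [← hq, LinearMap.mem_ker, map_sub, ← hx, ← hg]; simp
    exact ⟨(x, ⟨_, this⟩), by simp [σ]⟩
  have hker : LinearMap.ker σ ≤ LinearMap.ker τ := by
    rintro ⟨x, s⟩ hx
    have hx' : g x + s = 0 := by simpa [σ] using hx
    have hs : q s = 0 := LinearMap.mem_ker.1 (hq.ge s.2)
    have hpx : p x = 0 := by
      rw [← hg]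
      have := congrArg q hx'
      simpa [hs] using this
    obtain ⟨y, rfl⟩ := hd x hpx
    have h1 : (h y : N) = g (d y) := LinearMap.congr_fun hh y
    have h2 : s = - h y := by
      apply Subtype.ext
      rw [← h1] at hx'
      simpa using eq_neg_of_add_eq_zero_right hx'
    have h3 : f (h y) = ψ (d y) := LinearMap.congr_fun hψ y
    simp [τ, h2, h3]
  refine ⟨(LinearMap.ker σ).liftQ τ hker ∘ₗ (σ.quotKerEquivOfSurjective hσ).symm.toLinearMap, ?_⟩
  ext s
  have : (σ.quotKerEquivOfSurjective hσ).symm (s : N) = Submodule.Quotient.mk ((0 : P0), s) := by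
    rw [LinearEquiv.symm_apply_eq]
    simp [σ]
  simp [this, τ]

/-- If `N` is an indecomposable `A`-module with `Soc N ≅ L^{⊕ m}` and
`N / Soc N ≅ L'`, where `L, L'` are non-isomorphic simple modules with scalar
endomorphisms, then `m ≤ dim_ℂ Ext¹(L', L)`. -/
theorem indecomposable_socle_le_ext_dim
    (A : Type) [Ring A] [Algebra ℂ A]
    (L L' N : Type) [AddCommGroup L] [Module A L] [AddCommGroup L'] [Module A L']
    [AddCommGroup N] [Module A N]
    (hL : IsSimpleModule A L) (hL' : IsSimpleModule A L')
    (hne : IsEmpty (L ≃ₗ[A] L'))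
    (hEndL : ∀ f : L →ₗ[A] L, ∃ c : ℂ, ∀ x : L, f x = algebraMap ℂ A c • x)
    (hEndL' : ∀ f : L' →ₗ[A] L', ∃ c : ℂ, ∀ x : L', f x = algebraMap ℂ A c • x)
    (m : ℕ)
    (esoc : (socle A N) ≃ₗ[A] (Fin m → L))
    (equo : (N ⧸ socle A N) ≃ₗ[A] L')
    (hindec : Indecomposable A N) :
    (m : Cardinal) ≤ ext1Rank A L' L := by
  have key : ∀ (F : N →ₗ[A] L), F ∘ₗ (socle A N).subtype = 0 :=
    extends_eq_zero A L L' N hL hL' m esoc equo hindec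
  let P : ProjectiveResolution (ModuleCat.of A L') := ProjectiveResolution.of _
  let p : P.complex.X 0 ⟶ ModuleCat.of A L' := P.π.f 0
  have hpepi : Epi p := inferInstanceAs (Epi (P.π.f 0))
  have hp : Function.Surjective p.hom := (ModuleCat.epi_iff_surjective p).1 hpepi
  have hdp : P.complex.d 1 0 ≫ p = 0 := P.complex_d_comp_π_f_zero
  have hex : (ShortComplex.mk (P.complex.d 1 0) p hdp).Exact :=
    ShortComplex.exact_of_g_is_cokernel _ P.isColimitCokernelCofork
  rw [ShortComplex.moduleCat_exact_iff] at hex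
  let q : N →ₗ[A] L' := equo.toLinearMap ∘ₗ (socle A N).mkQ
  have hq : LinearMap.ker q = socle A N := by simp [q, LinearMap.ker_comp]
  have hqs : Function.Surjective q := equo.surjective.comp (Submodule.mkQ_surjective _)
  have hqe : Epi (ModuleCat.ofHom q) := (ModuleCat.epi_iff_surjective _).2 hqs
  let g : P.complex.X 0 ⟶ ModuleCat.of A N := Projective.factorThru p (ModuleCat.ofHom q)
  have hg : g ≫ ModuleCat.ofHom q = p := Projective.factorThru_comp _ _
  have hg' : q ∘ₗ g.hom = p.hom := congrArg ModuleCat.Hom.hom hg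
  have hmem : ∀ x, (g.hom ∘ₗ (P.complex.d 1 0).hom) x ∈ socle A N := by
    intro x
    rw [← hq, LinearMap.mem_ker]
    have h1 : (P.complex.d 1 0 ≫ g ≫ ModuleCat.ofHom q).hom x = 0 := by
      rw [hg, hdp]; rfl
    exact h1
  let h : P.complex.X 1 →ₗ[A] socle A N :=
    LinearMap.codRestrict _ (g.hom ∘ₗ (P.complex.d 1 0).hom) hmem
  have hh : (socle A N).subtype ∘ₗ h = g.hom ∘ₗ (P.complex.d 1 0).hom := by
    ext x; rfl
  have hd2 : P.complex.d 2 1 ≫ ModuleCat.ofHom h = 0 := by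
    ext x
    have h1 : (P.complex.d 2 1 ≫ P.complex.d 1 0 ≫ g).hom x = 0 := by
      simp
    exact h1
  let fi : Fin m → (ModuleCat.of A (socle A N) ⟶ ModuleCat.of A L) := fun i =>
    ModuleCat.ofHom (LinearMap.proj i ∘ₗ esoc.toLinearMap)
  let Φ : (Fin m → ℂ) →ₗ[ℂ] (ModuleCat.of A (socle A N) ⟶ ModuleCat.of A L) :=
    Fintype.linearCombination ℂ fi
  have hΦ : ∀ v s, (Φ v).hom s = ∑ i, algebraMap ℂ A (v i) • esoc s i := by
    intro v s
    simp only [Φ, Fintype.linearCombination_apply, ModuleCat.hom_sum, LinearMap.sum_apply]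
    rfl
  let c : (Fin m → ℂ) →ₗ[ℂ] (P.complex.X 1 ⟶ ModuleCat.of A L) :=
    Linear.leftComp ℂ _ (ModuleCat.ofHom h) ∘ₗ Φ
  have hc : ∀ v, c v = ModuleCat.ofHom h ≫ Φ v := fun v => rfl
  have main := rank_le_homology_aux (P.complex.linearYonedaObj ℂ (ModuleCat.of A L)) c
    (by
      intro v
      change P.complex.d 2 1 ≫ c v = 0
      rw [hc, ← Category.assoc, hd2, Limits.zero_comp])
    (by
      intro v ψ hψ
      replace hψ : P.complex.d 1 0 ≫ (show P.complex.X 0 ⟶ ModuleCat.of A L from ψ) = c v := hψ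
      obtain ⟨F, hF⟩ := extension_aux A (socle A N) q hq p.hom hp (P.complex.d 1 0).hom hex
        g.hom hg' h hh (Φ v).hom (ModuleCat.Hom.hom (show P.complex.X 0 ⟶ ModuleCat.of A L from ψ))
        (congrArg ModuleCat.Hom.hom hψ.symm)
      have h0 : (Φ v).hom = 0 := by rw [← hF]; exact key F
      have := IsSimpleModule.nontrivial A L
      obtain ⟨x, hx⟩ := exists_ne (0 : L)
      ext i
      by_contra hvi
      have h1 : (Φ v).hom (esoc.symm (Pi.single i x)) = 0 := by rw [h0]; rfl
      rw [hΦ] at h1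
      simp only [LinearEquiv.apply_symm_apply] at h1
      rw [Finset.sum_eq_single i (by intro j _ hj; simp [hj]) (by simp)] at h1
      simp only [Pi.single_eq_same] at h1
      apply hx
      have h2 : algebraMap ℂ A (v i)⁻¹ • algebraMap ℂ A (v i) • x = x := by
        rw [smul_smul, ← map_mul, inv_mul_cancel₀ hvi, map_one, one_smul]
      rw [← h2, h1, smul_zero])
  refine main.trans ?_
  exact (LinearEquiv.rank_eq (P.isoExt (R := ℂ) 1 (ModuleCat.of A L)).toLinearEquiv).ge
end

section
/- Let A be an associative unital ℂ-algebra and let L, L' be simple A-modules with L not isomorphic to L' and with End_A(L) = End_A(L') = ℂ. Then, as elements of ℕ ∪ {∞}, dim_ℂ Ext¹_A(L', L) equals the supremum of the set of natural numbers m for which there exists an indecomposable A-module N whose socle is isomorphic to the direct sum of m copies of L and with N/Soc(N) isomorphic to L'. -/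
open CategoryTheory

section ExtPart

open CategoryTheory Limits

variable {A : Type} [Ring A] [Algebra ℂ A]

lemma aux_smul_apply {X Y : ModuleCat.{0} A} (c : ℂ) (f : X ⟶ Y) (x : X) :
    (c • f).hom x = algebraMap ℂ A c • f.hom x := by
  rfl

/-- quotient of cycles by boundaries at degree one. -/
lemma aux_ext_surj (L' L : ModuleCat.{0} A) :
    ∃ (P : ModuleCat.{0} A) (π : P ⟶ L') (_ : Projective P) (_ : Epi π)
      (Φ : (ModuleCat.of A (LinearMap.ker π.hom) ⟶ L) →ₗ[ℂ]
        (((Ext ℂ (ModuleCat.{0} A) 1).obj (Opposite.op L')).obj L)),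
      Function.Surjective Φ ∧
      ∀ f, Φ f = 0 ↔ ∃ h : P ⟶ L, f = ModuleCat.ofHom (LinearMap.ker π.hom).subtype ≫ h := by
  obtain ⟨R⟩ : Nonempty (ProjectiveResolution L') := HasProjectiveResolution.out
  let π : R.complex.X 0 ⟶ L' := R.π.f 0
  have hπ : Epi π := inferInstanceAs (Epi (R.π.f 0))
  let d1 := R.complex.d 1 0
  let d2 := R.complex.d 2 1
  have hd1π : d1 ≫ π = 0 := R.complex_d_comp_π_f_zero
  have hex0 : (ShortComplex.mk d1 π hd1π).Exact :=
    ShortComplex.exact_of_g_is_cokernel _ R.isColimitCokernelCofork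
  have hex1 : (ShortComplex.mk d2 d1 (R.complex.d_comp_d 2 1 0)).Exact := R.exact_succ 0
  rw [ShortComplex.moduleCat_exact_iff] at hex0 hex1
  let K := ModuleCat.of A (LinearMap.ker π.hom)
  let ι : K ⟶ R.complex.X 0 := ModuleCat.ofHom (LinearMap.ker π.hom).subtype
  let p : R.complex.X 1 ⟶ K := ModuleCat.ofHom
    (d1.hom.codRestrict _ (fun x => by
      have := congr($hd1π x); exact this))
  have hpι : p ≫ ι = d1 := by ext; rfl
  have hp : Function.Surjective p := by
    rintro ⟨x, hx⟩
    obtain ⟨y, hy⟩ := hex0 x hx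
    exact ⟨y, Subtype.ext hy⟩
  have hpe : Epi p := (ModuleCat.epi_iff_surjective _).2 hp
  have hd2p : d2 ≫ p = 0 := by
    have : Mono ι := (ModuleCat.mono_iff_injective _).2 Subtype.val_injective
    rw [← cancel_mono ι, Category.assoc, hpι, zero_comp]
    exact R.complex.d_comp_d 2 1 0
  let S := (R.complex.linearYonedaObj ℂ L).sc' 0 1 2
  let e : (((Ext ℂ (ModuleCat.{0} A) 1).obj (Opposite.op L')).obj L) ≅ S.moduleCatLeftHomologyData.H :=
    R.isoExt 1 L ≪≫ (R.complex.linearYonedaObj ℂ L).homologyIsoSc' 0 1 2 (by simp) (by simp) ≪≫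
      S.moduleCatHomologyIso
  let α : (K ⟶ L) →ₗ[ℂ] LinearMap.ker S.g.hom :=
    LinearMap.codRestrict _ (Linear.leftComp ℂ L p) (fun f => by
      show d2 ≫ p ≫ f = 0
      rw [← Category.assoc, hd2p, zero_comp])
  let Φ : (K ⟶ L) →ₗ[ℂ] (((Ext ℂ (ModuleCat.{0} A) 1).obj (Opposite.op L')).obj L) :=
    e.symm.toLinearEquiv.toLinearMap ∘ₗ
      ((LinearMap.range S.moduleCatToCycles).mkQ ∘ₗ α)
  refine ⟨R.complex.X 0, π, inferInstance, hπ, Φ, ?_, ?_⟩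
  · have hα : Function.Surjective α := by
      rintro ⟨f, hf⟩
      change R.complex.X 1 ⟶ L at f
      change d2 ≫ f = 0 at hf
      have hk : LinearMap.ker p.hom ≤ LinearMap.ker f.hom := by
        intro x hx
        have hx' : d1 x = 0 := by
          rw [← hpι]
          exact congr(ι.hom $hx)
        obtain ⟨y, rfl⟩ := hex1 x hx'
        exact congr($hf y)
      let g : K ⟶ L := ModuleCat.ofHom
        ((LinearMap.ker p.hom).liftQ f.hom hk ∘ₗ
          (p.hom.quotKerEquivOfSurjective hp).symm.toLinearMap)
      refine ⟨g, Subtype.ext ?_⟩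
      show p ≫ g = f
      ext x
      show (LinearMap.ker p.hom).liftQ f.hom hk
          ((p.hom.quotKerEquivOfSurjective hp).symm (p.hom x)) = f.hom x
      rw [show (p.hom.quotKerEquivOfSurjective hp).symm (p.hom x) = Submodule.Quotient.mk x by
        rw [LinearEquiv.symm_apply_eq]; rfl]
      rfl
    exact e.symm.toLinearEquiv.surjective.comp
      ((Submodule.mkQ_surjective _).comp hα)
  · intro f
    have h1 : Φ f = 0 ↔ α f ∈ LinearMap.range S.moduleCatToCycles := by
      rw [← Submodule.Quotient.mk_eq_zero]
      exact e.symm.toLinearEquiv.map_eq_zero_iff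
    rw [h1]
    constructor
    · rintro ⟨h, hh⟩
      change R.complex.X 0 ⟶ L at h
      refine ⟨h, ?_⟩
      have : d1 ≫ h = p ≫ f := congr_arg Subtype.val hh
      rw [← hpι, Category.assoc, cancel_epi] at this
      exact this.symm
    · rintro ⟨h, hh⟩
      refine ⟨h, Subtype.ext ?_⟩
      show d1 ≫ h = p ≫ f
      rw [hh, ← hpι, Category.assoc]

/-- no nontrivial combination of the `f i` extends to `P`. -/
def AuxIndep {P L L' : Type} [AddCommGroup P] [Module A P] [AddCommGroup L] [Module A L]
    [AddCommGroup L'] [Module A L'] (π : P →ₗ[A] L') {m : ℕ}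
    (f : Fin m → (LinearMap.ker π →ₗ[A] L)) : Prop :=
  ∀ c : Fin m → ℂ, (∃ h : P →ₗ[A] L, ∀ k : LinearMap.ker π,
    h k = ∑ i, algebraMap ℂ A (c i) • f i k) → c = 0

lemma aux_ext (L' L : Type) [AddCommGroup L] [Module A L]
    [AddCommGroup L'] [Module A L'] :
    ∃ (P : ModuleCat.{0} A) (π : P →ₗ[A] L'), Module.Projective A P ∧ Function.Surjective π ∧
      ∀ m : ℕ, (m : Cardinal) ≤ ext1Rank A L' L ↔
        ∃ f : Fin m → (LinearMap.ker π →ₗ[A] L), AuxIndep π f := by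
  obtain ⟨P, π, hP, hπ, Φ, hΦ, hker⟩ := aux_ext_surj (ModuleCat.of A L') (ModuleCat.of A L)
  refine ⟨P, π.hom, (IsProjective.iff_projective P).2 hP,
    (ModuleCat.epi_iff_surjective _).1 hπ, fun m => ?_⟩
  have key : ∀ f : Fin m → (ModuleCat.of A (LinearMap.ker π.hom) ⟶ ModuleCat.of A L),
      LinearIndependent ℂ (fun i => Φ (f i)) ↔ AuxIndep π.hom (fun i => (f i).hom) := by
    intro f
    rw [Fintype.linearIndependent_iff]
    unfold AuxIndep
    refine forall_congr' fun c => ?_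
    rw [funext_iff]
    refine imp_congr ?_ Iff.rfl
    rw [show ∑ i, c i • Φ (f i) = Φ (∑ i, c i • f i) by simp, hker]
    have hs : ∀ k, (∑ i, c i • f i).hom k = ∑ i, algebraMap ℂ A (c i) • (f i).hom k := by
      intro k
      rw [ModuleCat.hom_sum, LinearMap.sum_apply]
      rfl
    constructor
    · rintro ⟨h, hh⟩
      refine ⟨h.hom, fun k => ?_⟩
      rw [← hs, hh]
      rfl
    · rintro ⟨h, hh⟩
      refine ⟨ModuleCat.ofHom h, ?_⟩
      ext k
      rw [hs, ← hh]
      rfl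
  have h1 : (m : Cardinal) ≤ ext1Rank A L' L ↔ ∃ v : Fin m →
      (((Ext ℂ (ModuleCat.{0} A) 1).obj (Opposite.op (ModuleCat.of A L'))).obj
      (ModuleCat.of A L)), LinearIndependent ℂ v :=
    Module.le_rank_iff
  rw [h1]
  constructor
  · rintro ⟨v, hv⟩
    choose f hf using fun i => hΦ (v i)
    exact ⟨_, (key f).1 (by simpa only [hf] using hv)⟩
  · rintro ⟨f, hf⟩
    exact ⟨_, (key (fun i => ModuleCat.ofHom (f i))).2 hf⟩

end ExtPart

section ModPart

variable {A : Type} [Ring A] {N L L' : Type} [AddCommGroup N] [Module A N]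
  [AddCommGroup L] [Module A L] [AddCommGroup L'] [Module A L']

lemma aux_mem_socle [IsSimpleModule A L] (g : L →ₗ[A] N) (x : L) : g x ∈ socle A N := by
  rcases g.injective_or_eq_zero with h | h
  · have hs : IsSimpleModule A (LinearMap.range g) :=
      IsSimpleModule.congr (LinearEquiv.ofInjective g h).symm
    exact (le_sSup (show LinearMap.range g ∈ {m : Submodule A N | IsSimpleModule A ↥m} from hs))
      ⟨x, rfl⟩
  · simp [h]

lemma aux_pi_mem_socle [IsSimpleModule A L] {m : ℕ} (g : (Fin m → L) →ₗ[A] N) (x : Fin m → L) :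
    g x ∈ socle A N := by
  rw [← Finset.univ_sum_single x, map_sum]
  exact Submodule.sum_mem _ fun i _ =>
    aux_mem_socle (g ∘ₗ LinearMap.single A (fun _ => L) i) (x i)

lemma aux_core [IsSimpleModule A L] [IsSimpleModule A L'] {m : ℕ} (hm : 0 < m)
    (j : (Fin m → L) →ₗ[A] N) (hj : Function.Injective j)
    (ρ : N →ₗ[A] L') (hρ : Function.Surjective ρ) (hex : LinearMap.range j = LinearMap.ker ρ)
    (hr : ∀ r : N →ₗ[A] L, r ∘ₗ j = 0) :
    Indecomposable A N ∧ Nonempty ((socle A N) ≃ₗ[A] (Fin m → L)) ∧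
      Nonempty ((N ⧸ socle A N) ≃ₗ[A] L') := by
  have hco : IsCoatom (LinearMap.range j) := by
    rw [hex, ← isSimpleModule_iff_isCoatom]
    exact IsSimpleModule.congr (ρ.quotKerEquivOfSurjective hρ)
  -- a projection onto the range of `j` cannot exist
  have hnp : ∀ r : N →ₗ[A] N, (∀ x, r x ∈ LinearMap.range j) → ∀ x, r (j x) = 0 := by
    intro r h x
    let e := LinearEquiv.ofInjective j hj
    let r' : N →ₗ[A] LinearMap.range j := r.codRestrict _ h
    have h0 : e.symm (r' (j x)) = 0 := by
      funext i
      exact LinearMap.congr_fun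
        (hr (LinearMap.proj i ∘ₗ e.symm.toLinearMap ∘ₗ r')) x
    have h1 : r' (j x) = 0 := by simpa using h0
    exact congr_arg Subtype.val h1
  have : Nontrivial L := IsSimpleModule.nontrivial A L
  obtain ⟨y, hy⟩ := exists_ne (0 : L)
  have hjy : j (fun _ => y) ≠ 0 := by
    intro h
    have := hj (h.trans (map_zero j).symm)
    exact hy (congr_fun this ⟨0, hm⟩)
  have hsoc : socle A N = LinearMap.range j := by
    apply le_antisymm
    · refine sSup_le fun S hS => ?_
      have hS : IsSimpleModule A S := hS
      have hat : IsAtom S := isSimpleModule_iff_isAtom.1 hS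
      by_contra hle
      have hc : IsCompl (LinearMap.range j) S := by
        constructor
        · rw [disjoint_comm]
          exact hat.not_le_iff_disjoint.1 hle
        · exact hco.not_le_iff_codisjoint.1 hle
      have := hnp ((LinearMap.range j).projection S hc)
        (fun x => Submodule.projection_apply_mem hc x) (fun _ => y)
      rw [Submodule.projection_apply_of_mem_left hc ⟨_, rfl⟩] at this
      exact hjy this
    · rintro _ ⟨x, rfl⟩
      exact aux_pi_mem_socle j x
  refine ⟨⟨⟨_, _, hjy⟩, ?_⟩, ?_, ?_⟩
  · have hle : ∀ p q : Submodule A N, IsCompl p q → p ≤ LinearMap.range j → p = ⊥ := by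
      intro p q h hp
      rw [eq_bot_iff]
      intro x hx
      obtain ⟨z, rfl⟩ := hp hx
      have := hnp (p.projection q h) (fun x => hp (Submodule.projection_apply_mem h x)) z
      rw [Submodule.projection_apply_of_mem_left h hx] at this
      simp [this]
    intro p q h
    by_cases hp : p ≤ LinearMap.range j
    · exact Or.inl (hle p q h hp)
    · right
      refine hle q p h.symm ?_
      intro x hx
      have hx' : x ∈ LinearMap.range j ⊔ p := by
        rw [(hco.not_le_iff_codisjoint.1 hp).eq_top]; trivial
      obtain ⟨_, ⟨b, rfl⟩, a, ha, hab⟩ := Submodule.mem_sup.1 hx'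
      have h2 : q.projection p h.symm (j b) = x := by
        have h3 := congr_arg (q.projection p h.symm) hab
        rw [map_add, Submodule.projection_apply_of_mem_right h.symm ha, add_zero,
          Submodule.projection_apply_of_mem_left h.symm hx] at h3
        exact h3
      rw [← hsoc, ← h2]
      exact aux_pi_mem_socle (q.projection p h.symm ∘ₗ j) b
  · rw [hsoc]
    exact ⟨(LinearEquiv.ofInjective j hj).symm⟩
  · rw [hsoc, hex]
    exact ⟨ρ.quotKerEquivOfSurjective hρ⟩

variable [Algebra ℂ A]

lemma aux_forward {P : Type} [AddCommGroup P] [Module A P]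
    [IsSimpleModule A L] [IsSimpleModule A L']
    (hEndL : ∀ f : L →ₗ[A] L, ∃ c : ℂ, ∀ x : L, f x = algebraMap ℂ A c • x)
    {m : ℕ} (hm : 0 < m) (π : P →ₗ[A] L') (hπ : Function.Surjective π)
    (f : Fin m → (LinearMap.ker π →ₗ[A] L)) (hf : AuxIndep π f) :
    ∃ N : ModuleCat.{0} A, Indecomposable A N ∧
        Nonempty ((socle A N) ≃ₗ[A] (Fin m → L)) ∧
        Nonempty ((N ⧸ socle A N) ≃ₗ[A] L') := by
  let F : LinearMap.ker π →ₗ[A] (Fin m → L) := LinearMap.pi f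
  let W : Submodule A (P × (Fin m → L)) :=
    LinearMap.range ((LinearMap.ker π).subtype.prod (-F))
  let j : (Fin m → L) →ₗ[A] ((P × (Fin m → L)) ⧸ W) := W.mkQ ∘ₗ LinearMap.inr A P (Fin m → L)
  let g : P →ₗ[A] ((P × (Fin m → L)) ⧸ W) := W.mkQ ∘ₗ LinearMap.inl A P (Fin m → L)
  have hW : W ≤ LinearMap.ker (π ∘ₗ LinearMap.fst A P (Fin m → L)) := by
    rintro _ ⟨k, rfl⟩
    exact k.2
  let ρ : ((P × (Fin m → L)) ⧸ W) →ₗ[A] L' := W.liftQ (π ∘ₗ LinearMap.fst A P (Fin m → L)) hW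
  have hgj : ∀ k : LinearMap.ker π, g k = j (F k) := by
    intro k
    refine (Submodule.Quotient.eq W).2 ⟨k, ?_⟩
    ext <;> simp
  refine ⟨ModuleCat.of A ((P × (Fin m → L)) ⧸ W), aux_core hm j ?_ ρ ?_ ?_ ?_⟩
  · rw [injective_iff_map_eq_zero]
    intro x hx
    obtain ⟨k, hk⟩ := (Submodule.Quotient.mk_eq_zero W).1 hx
    have h1 : k = 0 := Subtype.ext (congr_arg Prod.fst hk)
    have h2 : -F k = x := congr_arg Prod.snd hk
    rw [← h2, h1]; simp
  · intro y
    obtain ⟨p, rfl⟩ := hπ y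
    exact ⟨g p, rfl⟩
  · apply le_antisymm
    · rintro _ ⟨x, rfl⟩
      exact map_zero π
    · intro y hy
      obtain ⟨⟨p, x⟩, rfl⟩ := W.mkQ_surjective y
      have hp : π p = 0 := hy
      refine ⟨x + F ⟨p, hp⟩, ?_⟩
      refine (Submodule.Quotient.eq W).2 ⟨-⟨p, hp⟩, ?_⟩
      ext <;> simp
  · intro r
    choose c hc using fun i => hEndL (r ∘ₗ j ∘ₗ LinearMap.single A (fun _ => L) i)
    have hrj : ∀ x, r (j x) = ∑ i, algebraMap ℂ A (c i) • x i := by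
      intro x
      conv_lhs => rw [← Finset.univ_sum_single x, map_sum, map_sum]
      exact Finset.sum_congr rfl fun i _ => hc i (x i)
    have hc0 : c = 0 := hf c ⟨r ∘ₗ g, fun k => by
      show r (g k) = _
      rw [hgj, hrj]; rfl⟩
    ext1 x
    ext y
    simp [hrj, hc0]

lemma aux_backward {P : Type} [AddCommGroup P] [Module A P] [Module.Projective A P]
    [IsSimpleModule A L] [IsSimpleModule A L']
    {m : ℕ} (π : P →ₗ[A] L') (hπ : Function.Surjective π)
    (hN : Indecomposable A N)
    (s : (socle A N) ≃ₗ[A] (Fin m → L))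
    (q : (N ⧸ socle A N) ≃ₗ[A] L') :
    ∃ f : Fin m → (LinearMap.ker π →ₗ[A] L), AuxIndep π f := by
  obtain ⟨g, hg⟩ := Module.projective_lifting_property
    (q.toLinearMap ∘ₗ (socle A N).mkQ) π (q.surjective.comp (Submodule.mkQ_surjective _))
  have hg' : ∀ p, q (Submodule.Quotient.mk (g p)) = π p := fun p => LinearMap.congr_fun hg p
  have hker : ∀ p, g p ∈ socle A N ↔ p ∈ LinearMap.ker π := by
    intro p
    rw [LinearMap.mem_ker, ← hg', LinearEquiv.map_eq_zero_iff, Submodule.Quotient.mk_eq_zero]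
  let G : LinearMap.ker π →ₗ[A] socle A N :=
    (g ∘ₗ (LinearMap.ker π).subtype).codRestrict _ (fun k => (hker k).2 k.2)
  refine ⟨fun i => LinearMap.proj i ∘ₗ s.toLinearMap ∘ₗ G, ?_⟩
  rintro c ⟨h, hh⟩
  by_contra hc
  obtain ⟨i₀, hi₀⟩ := Function.ne_iff.1 hc
  replace hi₀ : c i₀ ≠ 0 := hi₀
  let φ : socle A N →ₗ[A] L :=
    { toFun := fun x => ∑ i, algebraMap ℂ A (c i) • s x i
      map_add' := fun x y => by simp [Finset.sum_add_distrib]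
      map_smul' := fun a x => by
        simp only [map_smul, Pi.smul_apply, Finset.smul_sum, RingHom.id_apply, smul_smul,
          Algebra.commutes] }
  have hφ : ∀ k : LinearMap.ker π, h k = φ (G k) := hh
  let T : P × socle A N →ₗ[A] N := g.coprod (socle A N).subtype
  let U : P × socle A N →ₗ[A] L := h.coprod φ
  have hT : Function.Surjective T := by
    intro n
    obtain ⟨p, hp⟩ := hπ (q (Submodule.Quotient.mk n))
    rw [← hg', q.injective.eq_iff, eq_comm, Submodule.Quotient.eq] at hp
    exact ⟨(p, ⟨_, hp⟩), by simp [T]⟩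
  have hTU : LinearMap.ker T ≤ LinearMap.ker U := by
    rintro ⟨p, x⟩ hx
    have hx : g p + (x : N) = 0 := hx
    have hgp : g p = -(x : N) := eq_neg_of_add_eq_zero_left hx
    have hp : p ∈ LinearMap.ker π := (hker p).1 (by rw [hgp]; exact neg_mem x.2)
    have hGx : G ⟨p, hp⟩ = -x := Subtype.ext hgp
    show h p + φ x = 0
    rw [show h p = φ (G ⟨p, hp⟩) from hφ ⟨p, hp⟩, hGx]
    simp
  let t : N →ₗ[A] L := (LinearMap.ker T).liftQ U hTU ∘ₗ
    (T.quotKerEquivOfSurjective hT).symm.toLinearMap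
  have ht : ∀ z, t (T z) = U z := by
    intro z
    show (LinearMap.ker T).liftQ U hTU ((T.quotKerEquivOfSurjective hT).symm (T z)) = U z
    rw [show (T.quotKerEquivOfSurjective hT).symm (T z) = Submodule.Quotient.mk z by
        rw [LinearEquiv.symm_apply_eq]; rfl]
    rfl
  have htφ : ∀ x : socle A N, t x = φ x := by
    intro x
    have := ht (0, x)
    simpa [T, U] using this
  have : Nontrivial L := IsSimpleModule.nontrivial A L
  let σ : L →ₗ[A] N := (socle A N).subtype ∘ₗ s.symm.toLinearMap ∘ₗ
    LinearMap.single A (fun _ => L) i₀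
  have htσ : ∀ x, t (σ x) = algebraMap ℂ A (c i₀) • x := by
    intro x
    refine (htφ _).trans ?_
    show ∑ i, algebraMap ℂ A (c i) • s (s.symm (Pi.single i₀ x)) i = _
    rw [LinearEquiv.apply_symm_apply, Finset.sum_eq_single i₀]
    · simp
    · intro i _ hi
      simp [hi]
    · simp
  have hinv : ∀ x : L, algebraMap ℂ A (c i₀)⁻¹ • algebraMap ℂ A (c i₀) • x = x := by
    intro x
    rw [smul_smul, ← map_mul, inv_mul_cancel₀ hi₀, map_one, one_smul]
  have hinv' : ∀ x : L, algebraMap ℂ A (c i₀) • algebraMap ℂ A (c i₀)⁻¹ • x = x := by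
    intro x
    rw [smul_smul, ← map_mul, mul_inv_cancel₀ hi₀, map_one, one_smul]
  have hcompl : IsCompl (LinearMap.ker t) (LinearMap.range σ) := by
    constructor
    · rw [Submodule.disjoint_def]
      rintro _ hx ⟨x, rfl⟩
      have h0 : t (σ x) = 0 := hx
      rw [htσ] at h0
      rw [← hinv x, h0]
      simp
    · rw [codisjoint_iff, eq_top_iff]
      intro n _
      refine Submodule.mem_sup.2 ⟨n - σ (algebraMap ℂ A (c i₀)⁻¹ • t n), ?_,
        σ (algebraMap ℂ A (c i₀)⁻¹ • t n), ⟨_, rfl⟩, by simp⟩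
      rw [LinearMap.mem_ker, map_sub, htσ, hinv', sub_self]
  rcases hN.2 _ _ hcompl with h1 | h1
  · -- `N` embeds in `L`, so the range of `σ` is everything and the socle is everything
    have htop : LinearMap.range σ = ⊤ := by
      have := hcompl.sup_eq_top
      rwa [h1, bot_sup_eq] at this
    have hs : socle A N = ⊤ := by
      rw [eq_top_iff, ← htop]
      rintro _ ⟨x, rfl⟩
      exact aux_mem_socle σ x
    have : Nontrivial L' := IsSimpleModule.nontrivial A L'
    obtain ⟨y, hy⟩ := exists_ne (0 : L')
    obtain ⟨z, rfl⟩ := q.surjective y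
    obtain ⟨n, rfl⟩ := Submodule.mkQ_surjective _ z
    apply hy
    rw [show (socle A N).mkQ n = 0 from
      (Submodule.Quotient.mk_eq_zero _).2 (by rw [hs]; trivial), map_zero]
  · obtain ⟨y, hy⟩ := exists_ne (0 : L)
    have h0 : σ y = 0 := by
      have : σ y ∈ LinearMap.range σ := ⟨y, rfl⟩
      rw [h1] at this
      simpa using this
    apply hy
    rw [← hinv y, ← htσ, h0]
    simp

end ModPart

/-- For non-isomorphic simple modules `L, L'` with scalar endomorphisms,
`dim_ℂ Ext¹(L', L)`, as an element of `ℕ ∪ {∞}`, equals the supremum of the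
set of `m ∈ ℕ` for which there is an indecomposable module `N` with
`Soc N ≅ L^{⊕ m}` and `N / Soc N ≅ L'`. -/
theorem ext_dim_eq_sSup_indecomposable
    (A : Type) [Ring A] [Algebra ℂ A]
    (L L' : Type) [AddCommGroup L] [Module A L] [AddCommGroup L'] [Module A L']
    (hL : IsSimpleModule A L) (hL' : IsSimpleModule A L')
    (hne : IsEmpty (L ≃ₗ[A] L'))
    (hEndL : ∀ f : L →ₗ[A] L, ∃ c : ℂ, ∀ x : L, f x = algebraMap ℂ A c • x)
    (hEndL' : ∀ f : L' →ₗ[A] L', ∃ c : ℂ, ∀ x : L', f x = algebraMap ℂ A c • x) :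
    Cardinal.toENat (ext1Rank A L' L) =
      ⨆ m ∈ {m : ℕ | ∃ N : ModuleCat.{0} A, Indecomposable A N ∧
        Nonempty ((socle A N) ≃ₗ[A] (Fin m → L)) ∧
        Nonempty ((N ⧸ socle A N) ≃ₗ[A] L')}, (m : ℕ∞) := by
  obtain ⟨P, π, hP, hπ, hrank⟩ := aux_ext (A := A) L' L
  apply le_antisymm
  · refine ENat.forall_natCast_le_iff_le.mp fun m hm => ?_
    rcases Nat.eq_zero_or_pos m with rfl | hpos
    · simp
    · rw [Cardinal.natCast_le_toENat, hrank] at hm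
      obtain ⟨f, hf⟩ := hm
      exact le_iSup₂_of_le (f := fun (m : ℕ) _ => (m : ℕ∞)) m
        (aux_forward hEndL hpos π hπ f hf) le_rfl
  · refine iSup₂_le fun m hm => ?_
    obtain ⟨N, hN, ⟨s⟩, ⟨q⟩⟩ := hm
    rw [Cardinal.natCast_le_toENat, hrank]
    exact aux_backward π hπ hN s q
end

section
/- Let (V, E, b, deg) be a bimarked graph equipped with a ℤ-grading ι : V → ℤ (so ι(ν) ≤ ι(λ) for every edge ν → λ) and satisfying condition (BB): for every path ν₁ →e₁→ ν₂ →e₂→ ν₃ of length 2 one has b(e₁) ≠ b(e₂). Assume moreover: (a) for every pair of vertices, the sets of decreasing paths and of increasing paths between them are finite; (b) for all vertices μ, λ, the set of pairs (P, Q) where P is a decreasing path starting at μ and Q is an increasing path ending at λ with P ending at the starting vertex of Q is finite, and likewise the set of pairs (P, Q) with P increasing starting at μ and Q decreasing ending at λ and P ending where Q starts is finite. Define a^>_{λ,ν} := Σ_{P ∈ 𝒫^>(ν,λ)} (−1)^{deg(P)+length(P)} and a^<_{λ,ν} := Σ_{P ∈ 𝒫^<(ν,λ)} (−1)^{deg(P)}.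 Then for all vertices λ, μ one has Σ_{ν ∈ V} a^<_{λ,ν} · a^>_{ν,μ} = δ_{λ,μ} and Σ_{ν ∈ V} a^>_{λ,ν} · a^<_{ν,μ} = δ_{λ,μ}, i.e. the matrices A^< and A^> are mutually inverse. -/
/-- A bimarked graph: a directed multigraph with at most countable sets of
vertices and edges, whose edges carry two integer markings `b` and `deg`. -/
structure BimarkedGraph where
  V : Type
  E : Type
  vCountable : Countable V
  eCountable : Countable E
  src : E → V
  tgt : E → V
  b : E → ℤ
  deg : E → ℤ

namespace BimarkedGraph

/-- A (directed) path in a bimarked graph. -/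
inductive Walk (G : BimarkedGraph) : G.V → G.V → Type
  | nil (v : G.V) : Walk G v v
  | cons (e : G.E) {v : G.V} (w : Walk G (G.tgt e) v) : Walk G (G.src e) v

namespace Walk

variable {G : BimarkedGraph}

/-- The list of edges of a path. -/
def edgeList : ∀ {u v : G.V}, G.Walk u v → List G.E
  | _, _, .nil _ => []
  | _, _, .cons e w => e :: edgeList w

/-- The length of a path: its number of edges. -/
def length {u v : G.V} (w : G.Walk u v) : ℕ := w.edgeList.length

/-- `deg` of a path: the sum of the degrees of its edges. -/
def degSum {u v : G.V} (w : G.Walk u v) : ℤ := (w.edgeList.map G.deg).sum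

/-- A path is decreasing if the `b`-marks of its edges strictly decrease;
a path with no edges is decreasing. -/
def IsDecreasing {u v : G.V} (w : G.Walk u v) : Prop :=
  (w.edgeList.map G.b).Chain' (· > ·)

/-- A path is increasing if the `b`-marks of its edges strictly increase;
a path with no edges is increasing. -/
def IsIncreasing {u v : G.V} (w : G.Walk u v) : Prop :=
  (w.edgeList.map G.b).Chain' (· < ·)

end Walk

end BimarkedGraph

/-- `(-1) ^ n` for an integer `n`. -/
def negOnePow (n : ℤ) : ℤ := (((-1 : ℤˣ) ^ n : ℤˣ) : ℤ)

/-- The matrix entry `a^>_{λ,ν} = Σ_{P ∈ 𝒫^>(ν,λ)} (-1)^{deg P + length P}`. -/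
noncomputable def aGT (G : BimarkedGraph) (l n : G.V) : ℤ :=
  ∑ᶠ P : {w : G.Walk n l // w.IsDecreasing}, negOnePow (P.1.degSum + P.1.length)

/-- The matrix entry `a^<_{λ,ν} = Σ_{P ∈ 𝒫^<(ν,λ)} (-1)^{deg P}`. -/
noncomputable def aLT (G : BimarkedGraph) (l n : G.V) : ℤ :=
  ∑ᶠ P : {w : G.Walk n l // w.IsIncreasing}, negOnePow P.1.degSum

namespace BimarkedGraph

/-- A list of edges is a path from `u` to `v`. -/
def IsPath (G : BimarkedGraph) : G.V → G.V → List G.E → Prop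
  | u, v, [] => u = v
  | u, v, e :: L => G.src e = u ∧ IsPath G (G.tgt e) v L

theorem isPath_append (G : BimarkedGraph) (L M : List G.E) : ∀ u v : G.V,
    G.IsPath u v (L ++ M) ↔ ∃ x, G.IsPath u x L ∧ G.IsPath x v M := by
  induction L with
  | nil => intro u v; simp [IsPath]
  | cons e L ih => intro u v; simp [IsPath, ih, and_assoc]

theorem isPath_edgeList (G : BimarkedGraph) {u v : G.V} (w : G.Walk u v) :
    G.IsPath u v w.edgeList := by
  induction w with
  | nil v => simp [IsPath, Walk.edgeList]
  | cons e w ih => simp [IsPath, Walk.edgeList, ih]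

theorem exists_walk (G : BimarkedGraph) (L : List G.E) : ∀ u v : G.V,
    G.IsPath u v L → ∃ w : G.Walk u v, w.edgeList = L := by
  induction L with
  | nil =>
    intro u v h
    simp only [IsPath] at h
    subst h
    exact ⟨.nil _, rfl⟩
  | cons e L ih =>
    rintro u v ⟨h, h2⟩
    subst h
    obtain ⟨w, hw⟩ := ih _ _ h2
    exact ⟨.cons e w, by simp [Walk.edgeList, hw]⟩

theorem edgeList_inj (G : BimarkedGraph) {u x : G.V} (w : G.Walk u x) :
    ∀ {u' x' : G.V} (w' : G.Walk u' x'), u = u' → w.edgeList = w'.edgeList →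
      x = x' ∧ HEq w w' := by
  induction w with
  | nil v =>
    intro u' x' w' h h2
    cases w' with
    | nil => subst h; exact ⟨rfl, HEq.rfl⟩
    | cons e w' => simp [Walk.edgeList] at h2
  | cons e w ih =>
    intro u' x' w' h h2
    cases w' with
    | nil => simp [Walk.edgeList] at h2
    | cons e' w' =>
      simp only [Walk.edgeList, List.cons.injEq] at h2
      obtain ⟨rfl, h2⟩ := h2
      obtain ⟨rfl, h3⟩ := ih w' rfl h2
      cases h3
      exact ⟨rfl, HEq.rfl⟩

theorem edgeList_injective (G : BimarkedGraph) {u x : G.V} (w w' : G.Walk u x)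
    (h : w.edgeList = w'.edgeList) : w = w' :=
  eq_of_heq (edgeList_inj G w w' rfl h).2

open scoped Classical in
/-- The sign-reversing involution: move the edge at the break point. -/
noncomputable def flip (G : BimarkedGraph) (r : ℤ → ℤ → Prop) :
    List G.E × List G.E → List G.E × List G.E
  | ([], []) => ([], [])
  | (p :: R, []) => (R, [p])
  | ([], q :: Q) => ([q], Q)
  | (p :: R, q :: Q) => if r (G.b p) (G.b q) then (R, p :: q :: Q) else (q :: p :: R, Q)

open scoped Classical in
theorem core (G : BimarkedGraph) (r : ℤ → ℤ → Prop) (hr : ∀ a b, r a b → ¬ r b a)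
    (hr2 : ∀ a b, a ≠ b → ¬ r a b → r b a)
    (hBB : ∀ e f : G.E, G.tgt e = G.src f → G.b e ≠ G.b f) (u v : G.V)
    (S : Finset (List G.E × List G.E))
    (hS : ∀ p, p ∈ S ↔ G.IsPath u v (p.1.reverse ++ p.2) ∧ (p.1.map G.b).IsChain r ∧
      (p.2.map G.b).IsChain r)
    (f : List G.E × List G.E → ℤ)
    (hf : ∀ e R Q, f (e :: R, Q) = - f (R, e :: Q)) (hf0 : f ([], []) = 1) :
    ∑ p ∈ S, f p = if u = v then 1 else 0 := by
  have h0 : ∑ p ∈ S.erase ([], []), f p = 0 := by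
    refine Finset.sum_involution (fun p _ => G.flip r p) ?_ ?_ ?_ ?_
    · rintro ⟨_ | ⟨p, R⟩, _ | ⟨q, Q⟩⟩ h
      · simp at h
      · simp [flip, hf]
      · simp [flip, hf]
      · simp only [flip]
        split_ifs
        · rw [hf p R]; ring
        · rw [hf q]; ring
    · rintro ⟨_ | ⟨p, R⟩, _ | ⟨q, Q⟩⟩ h _
      · simp at h
      · simp [flip]
      · simp [flip]
      · simp only [flip]
        split_ifs
        · intro h; simpa using congrArg (fun p => p.1.length) h
        · intro h; simpa using congrArg (fun p => p.1.length) h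
    · rintro ⟨_ | ⟨p, R⟩, _ | ⟨q, Q⟩⟩ h
      · simp at h
      · simp only [Finset.mem_erase, hS] at h ⊢
        obtain ⟨-, h1, h2, h3⟩ := h
        simp only [flip]
        refine ⟨by simp, by simpa using h1, by simp, ?_⟩
        exact h3.tail
      · simp only [Finset.mem_erase, hS] at h ⊢
        obtain ⟨-, h1, h2, h3⟩ := h
        simp only [flip]
        refine ⟨by simp, by simpa using h1, h2.tail, by simp⟩
      · simp only [Finset.mem_erase, hS] at h ⊢
        obtain ⟨-, h1, h2, h3⟩ := h
        have hne : G.b p ≠ G.b q := by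
          apply hBB
          simp only [List.reverse_cons, List.append_assoc, isPath_append] at h1
          obtain ⟨x, -, y, hy, hz⟩ := h1
          simp only [IsPath] at hy hz
          rw [hy.2, hz.1]
        simp only [flip]
        split_ifs with hlt
        · refine ⟨by simp, by simpa using h1, h2.tail, ?_⟩
          simp only [List.map_cons, List.isChain_cons_cons] at h3 ⊢
          exact ⟨hlt, h3⟩
        · refine ⟨by simp, by simpa using h1, ?_, h3.tail⟩
          simp only [List.map_cons, List.isChain_cons_cons] at h2 ⊢
          exact ⟨hr2 _ _ hne hlt, h2⟩
    · rintro ⟨_ | ⟨p, R⟩, _ | ⟨q, Q⟩⟩ h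
      · simp at h
      · simp only [Finset.mem_erase, hS] at h
        obtain ⟨-, h1, h2, h3⟩ := h
        rcases Q with _ | ⟨q', Q⟩
        · simp [flip]
        · simp only [List.map_cons, List.isChain_cons_cons] at h3
          simp [flip, h3.1]
      · simp only [Finset.mem_erase, hS] at h
        obtain ⟨-, h1, h2, h3⟩ := h
        rcases R with _ | ⟨q', Q⟩
        · simp [flip]
        · simp only [List.map_cons, List.isChain_cons_cons] at h2
          simp [flip, hr _ _ h2.1]
      · simp only [Finset.mem_erase, hS] at h
        obtain ⟨-, h1, h2, h3⟩ := h
        by_cases hlt : r (G.b p) (G.b q)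
        · rcases R with _ | ⟨p', R⟩
          · simp [flip, hlt]
          · simp only [List.map_cons, List.isChain_cons_cons] at h2
            simp [flip, hlt, hr _ _ h2.1]
        · rcases Q with _ | ⟨q', Q⟩
          · simp [flip, hlt]
          · simp only [List.map_cons, List.isChain_cons_cons] at h3
            simp [flip, hlt, h3.1]
  have hm : (([], []) : List G.E × List G.E) ∈ S ↔ u = v := by
    rw [hS]; simp [IsPath]
  split_ifs with huv
  · rw [← Finset.add_sum_erase S f (hm.2 huv), h0, hf0, add_zero]
  · rw [Finset.erase_eq_of_notMem (fun h => huv (hm.1 h))] at h0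
    exact h0

open scoped Classical in
/-- Summing products over the intermediate vertex. -/
theorem main_aux (G : BimarkedGraph) (r : ℤ → ℤ → Prop) (hr : ∀ a b, r a b → ¬ r b a)
    (hr2 : ∀ a b, a ≠ b → ¬ r a b → r b a)
    (hBB : ∀ e f : G.E, G.tgt e = G.src f → G.b e ≠ G.b f) (u v : G.V)
    (A B : ∀ {x y : G.V}, G.Walk x y → Prop)
    (hA : ∀ {x y : G.V} (w : G.Walk x y), A w ↔ (w.edgeList.map G.b).IsChain (fun a b => r b a))
    (hB : ∀ {x y : G.V} (w : G.Walk x y), B w ↔ (w.edgeList.map G.b).IsChain r)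
    (hAf : ∀ u v : G.V, Finite {w : G.Walk u v // A w})
    (hBf : ∀ u v : G.V, Finite {w : G.Walk u v // B w})
    (hfin : Finite ((x : G.V) × ({w : G.Walk u x // A w} × {w : G.Walk x v // B w})))
    (f g : List G.E → ℤ)
    (hfg : ∀ e R Q, f (R ++ [e]) * g Q = - (f R * g (e :: Q))) (h0 : f [] * g [] = 1) :
    ∑ᶠ n : G.V, (∑ᶠ Q : {w : G.Walk n v // B w}, g Q.1.edgeList) *
        (∑ᶠ P : {w : G.Walk u n // A w}, f P.1.edgeList) = if u = v then 1 else 0 := by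
  have := fun x y => Fintype.ofFinite {w : G.Walk x y // A w}
  have := fun x y => Fintype.ofFinite {w : G.Walk x y // B w}
  have := Fintype.ofFinite ((x : G.V) × ({w : G.Walk u x // A w} × {w : G.Walk x v // B w}))
  let φ : ((x : G.V) × ({w : G.Walk u x // A w} × {w : G.Walk x v // B w})) →
      List G.E × List G.E := fun t => (t.2.1.1.edgeList.reverse, t.2.2.1.edgeList)
  have hφ : Function.Injective φ := by
    rintro ⟨x, ⟨P, hP⟩, ⟨Q, hQ⟩⟩ ⟨x', ⟨P', hP'⟩, ⟨Q', hQ'⟩⟩ h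
    simp only [φ, Prod.mk.injEq, List.reverse_inj] at h
    obtain ⟨h1, h2⟩ := h
    obtain ⟨rfl, h3⟩ := edgeList_inj G P P' rfl h1
    cases h3
    cases edgeList_injective G Q Q' h2
    rfl
  rw [← core G r hr hr2 hBB u v (Finset.univ.image φ) ?_ (fun p => f p.1.reverse * g p.2) ?_ ?_]
  · rw [Finset.sum_image hφ.injOn]
    simp only [finsum_eq_sum_of_fintype]
    rw [finsum_eq_sum_of_support_subset (s := Finset.univ.image
      (Sigma.fst : ((x : G.V) × ({w : G.Walk u x // A w} × {w : G.Walk x v // B w})) → G.V))]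
    · have hu : (Finset.univ : Finset ((x : G.V) ×
          ({w : G.Walk u x // A w} × {w : G.Walk x v // B w}))) =
          (Finset.univ.image (Sigma.fst : ((x : G.V) ×
          ({w : G.Walk u x // A w} × {w : G.Walk x v // B w})) → G.V)).sigma (fun _ => Finset.univ) := by
        ext t
        simp only [Finset.mem_univ, Finset.mem_sigma, Finset.mem_image, true_and, and_true,
          true_iff]
        exact ⟨t, rfl⟩
      conv_rhs => rw [hu]
      rw [Finset.sum_sigma]
      refine Finset.sum_congr rfl fun n _ => ?_
      rw [mul_comm, Finset.sum_mul_sum, ← Finset.univ_product_univ, Finset.sum_product]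
      simp [φ]
    · intro n hn
      rw [Function.mem_support] at hn
      have h1 := Finset.exists_ne_zero_of_sum_ne_zero (left_ne_zero_of_mul hn)
      have h2 := Finset.exists_ne_zero_of_sum_ne_zero (right_ne_zero_of_mul hn)
      obtain ⟨Q, -⟩ := h1
      obtain ⟨P, -⟩ := h2
      simp only [Finset.coe_image, Finset.coe_univ, Set.image_univ, Set.mem_range]
      exact ⟨⟨n, P, Q⟩, rfl⟩
  · rintro ⟨R, Q⟩
    simp only [Finset.mem_image, Finset.mem_univ, true_and]
    constructor
    · rintro ⟨⟨x, ⟨P, hP⟩, ⟨W, hW⟩⟩, h⟩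
      simp only [φ, Prod.mk.injEq] at h
      obtain ⟨rfl, rfl⟩ := h
      refine ⟨?_, ?_, (hB _).1 hW⟩
      · rw [isPath_append]
        exact ⟨x, by simpa using isPath_edgeList G P, isPath_edgeList G W⟩
      · simp only [List.map_reverse, List.isChain_reverse]
        exact (hA _).1 hP
    · rintro ⟨h1, h2, h3⟩
      rw [isPath_append] at h1
      obtain ⟨x, h4, h5⟩ := h1
      obtain ⟨P, hP⟩ := exists_walk G _ _ _ h4
      obtain ⟨W, hW⟩ := exists_walk G _ _ _ h5
      refine ⟨⟨x, ⟨P, ?_⟩, ⟨W, ?_⟩⟩, ?_⟩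
      · rw [hA, hP, List.map_reverse, List.isChain_reverse]
        exact h2
      · rw [hB, hW]; exact h3
      · simp [φ, hP, hW]
  · intro e R Q
    simpa using hfg e R.reverse Q
  · simpa using h0

end BimarkedGraph

theorem negOnePow_add (m n : ℤ) : negOnePow (m + n) = negOnePow m * negOnePow n := by
  simp [negOnePow, zpow_add]

theorem negOnePow_zero : negOnePow 0 = 1 := by simp [negOnePow]

theorem negOnePow_one : negOnePow 1 = -1 := by simp [negOnePow]

open scoped Classical in
/-- For a `ℤ`-graded bimarked graph satisfying (BB) and the finiteness
assumptions, the matrices `A^<` and `A^>` are mutually inverse: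
`A^< · A^> = A^> · A^< = Id`. -/
theorem aLT_mul_aGT_eq_delta (G : BimarkedGraph)
    (ι : G.V → ℤ) (hgrading : ∀ e : G.E, ι (G.src e) ≤ ι (G.tgt e))
    (hBB : ∀ e f : G.E, G.tgt e = G.src f → G.b e ≠ G.b f)
    (hfinDec : ∀ u v : G.V, Finite {w : G.Walk u v // w.IsDecreasing})
    (hfinInc : ∀ u v : G.V, Finite {w : G.Walk u v // w.IsIncreasing})
    (hfinDI : ∀ u v : G.V, Finite ((x : G.V) ×
        ({w : G.Walk u x // w.IsDecreasing} × {w : G.Walk x v // w.IsIncreasing})))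
    (hfinID : ∀ u v : G.V, Finite ((x : G.V) ×
        ({w : G.Walk u x // w.IsIncreasing} × {w : G.Walk x v // w.IsDecreasing}))) :
    ∀ l m : G.V,
      (∑ᶠ n : G.V, aLT G l n * aGT G n m) = (if l = m then 1 else 0) ∧
      (∑ᶠ n : G.V, aGT G l n * aLT G n m) = (if l = m then 1 else 0) := by
  intro l m
  have hc : ∀ a b : G.V, (if a = b then (1 : ℤ) else 0) = if b = a then 1 else 0 := by
    intro a b
    simp only [eq_comm]
  rw [hc l m]
  constructor
  · refine BimarkedGraph.main_aux G (· < ·) (fun a b h => by omega) (fun a b h h' => by omega)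
      hBB m l (fun w => w.IsDecreasing) (fun w => w.IsIncreasing) (fun w => Iff.rfl)
      (fun w => Iff.rfl) hfinDec hfinInc (hfinDI m l)
      (fun L => negOnePow ((L.map G.deg).sum + L.length))
      (fun L => negOnePow (L.map G.deg).sum) ?_ ?_
    · intro e R Q
      simp [negOnePow_add, negOnePow_one, negOnePow_zero]
      ring
    · simp [negOnePow_zero]
  · refine BimarkedGraph.main_aux G (· > ·) (fun a b h => by omega) (fun a b h h' => by omega)
      hBB m l (fun w => w.IsIncreasing) (fun w => w.IsDecreasing) (fun w => Iff.rfl)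
      (fun w => Iff.rfl) hfinInc hfinDec (hfinID m l)
      (fun L => negOnePow (L.map G.deg).sum)
      (fun L => negOnePow ((L.map G.deg).sum + L.length)) ?_ ?_
    · intro e R Q
      simp [negOnePow_add, negOnePow_one, negOnePow_zero]
      ring
    · simp [negOnePow_zero]
end
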